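/- arXiv:math/0702028 — 4 statements merged into one kernel-verified Lean document; each statement's English description precedes it below -/
import Mathlib

section
/- Let M be a nonzero module of finite uniform dimension n over a ring R, and let U₁ ⊕ ⋯ ⊕ Uₙ and V₁ ⊕ ⋯ ⊕ Vₙ be two direct sums of uniform submodules of M, each with n summands. Then, after a suitable permutation of the U_i, one has [U₁] = [V₁], ..., [Uₙ] = [Vₙ], i.e. U_i and V_i are essentially equivalent for each i. -/
/-!
Definitions following Bavula, "Primary decompositions for left Noetherian rings".
All modules are left modules over an associative ring `R` with 1.
-/

universe u v

section Defs

variable (R : Type u) [Ring R]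

/-- `N` is an essential submodule of the module `A`:
it intersects every nonzero submodule of `A` nontrivially. -/
def EssentialSub {A : Type v} [AddCommGroup A] [Module R A] (N : Submodule R A) : Prop :=
  ∀ L : Submodule R A, L ≠ ⊥ → N ⊓ L ≠ ⊥

/-- A module `A` is uniform: it is nonzero and every nonzero submodule is essential. -/
def UniformMod (A : Type v) [AddCommGroup A] [Module R A] : Prop :=
  Nontrivial A ∧ ∀ V : Submodule R A, V ≠ ⊥ → EssentialSub R V

/-- A submodule is uniform if it is uniform as a module. -/
def UniformSub {A : Type v} [AddCommGroup A] [Module R A] (U : Submodule R A) : Prop :=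
  UniformMod R ↥U

/-- `A` has finite uniform dimension:
it contains no infinite direct sum of nonzero submodules. -/
def FinUdim (A : Type v) [AddCommGroup A] [Module R A] : Prop :=
  ¬ ∃ f : ℕ → Submodule R A, (∀ n, f n ≠ ⊥) ∧ iSupIndep f

/-- `A` has uniform dimension `n`: there is an essential direct sum of `n`
uniform submodules of `A`. -/
def UdimEq (A : Type v) [AddCommGroup A] [Module R A] (n : ℕ) : Prop :=
  ∃ U : Fin n → Submodule R A, (∀ i, UniformSub R (U i)) ∧
    iSupIndep U ∧ EssentialSub R (⨆ i, U i)

/-- Essential equivalence of modules: they possess isomorphic essential submodules. -/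
def EssEquiv (A B : ModuleCat.{v} R) : Prop :=
  ∃ (L₁ : Submodule R A) (L₂ : Submodule R B),
    EssentialSub R L₁ ∧ EssentialSub R L₂ ∧ Nonempty (L₁ ≃ₗ[R] L₂)

/-- The left spectrum-style quotient: classes `[A]` of modules under essential
equivalence (for uniform modules these classes are the left primes). -/
def LeftSpec := Quot (EssEquiv R)

/-- The class `[A]` of the module `A` under essential equivalence. -/
def leftPrime (A : Type v) [AddCommGroup A] [Module R A] : LeftSpec.{u, v} R :=
  Quot.mk _ (ModuleCat.of R A)

/-- The set `As_R(A)` of associated left primes of `A`: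
the classes of the uniform submodules of `A`. -/
def leftAss (A : Type v) [AddCommGroup A] [Module R A] : Set (LeftSpec.{u, v} R) :=
  { x | ∃ U : Submodule R A, UniformSub R U ∧ x = leftPrime R ↥U }

/-- `A` is uniformly finite: every factor module of `A` has finite uniform dimension. -/
def UniformlyFinite (A : Type v) [AddCommGroup A] [Module R A] : Prop :=
  ∀ N : Submodule R A, FinUdim R (A ⧸ N)

/-- `N` is an `X`-primary submodule of `A`: `A/N` has finite uniform dimension and
`As_R(A/N) = {X}`. -/
def PrimarySub {A : Type v} [AddCommGroup A] [Module R A] (N : Submodule R A)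
    (X : LeftSpec.{u, v} R) : Prop :=
  FinUdim R (A ⧸ N) ∧ leftAss R (A ⧸ N) = {X}

/-- `Ns` is a primary decomposition of `N` in `A`. -/
def IsPrimaryDecomp {A : Type v} [AddCommGroup A] [Module R A] (N : Submodule R A)
    (s : ℕ) (Ns : Fin s → Submodule R A) : Prop :=
  N = ⨅ i, Ns i ∧ ∀ i, ∃ X, PrimarySub R (Ns i) X

/-- `Ns` is a shortest primary decomposition of `N` in `A`:
no primary decomposition of `N` in `A` has fewer terms. -/
def IsShortestPrimaryDecomp {A : Type v} [AddCommGroup A] [Module R A] (N : Submodule R A)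
    (s : ℕ) (Ns : Fin s → Submodule R A) : Prop :=
  IsPrimaryDecomp R N s Ns ∧
    ∀ (t : ℕ) (Ls : Fin t → Submodule R A), IsPrimaryDecomp R N t Ls → s ≤ t

/-- `C` is a complement to `W` in the ambient module: `W ⊓ C = ⊥` and `C` is maximal
with this property. -/
def IsComplementTo {A : Type v} [AddCommGroup A] [Module R A] (C W : Submodule R A) : Prop :=
  W ⊓ C = ⊥ ∧ ∀ D : Submodule R A, C ≤ D → W ⊓ D = ⊥ → D = C

/-- A proper submodule `N ⊊ A` is irreducible if it is not the intersection of two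
strictly larger submodules. -/
def IrreducibleSub {A : Type v} [AddCommGroup A] [Module R A] (N : Submodule R A) : Prop :=
  N ≠ ⊤ ∧ ¬ ∃ P Q : Submodule R A, N < P ∧ N < Q ∧ N = P ⊓ Q

/-- The multiplicity of the left prime `x` in `A` is `m`: in some (equivalently, any)
essential direct sum of uniform submodules of `A`, exactly `m` summands lie in class `x`. -/
def HasMult (A : Type v) [AddCommGroup A] [Module R A] (x : LeftSpec.{u, v} R) (m : ℕ) : Prop :=
  ∃ (n : ℕ) (U : Fin n → Submodule R A), (∀ i, UniformSub R (U i)) ∧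
    iSupIndep U ∧ EssentialSub R (⨆ i, U i) ∧
    m = Nat.card {i : Fin n // leftPrime R ↥(U i) = x}

end Defs
section Lattice

variable {α : Type*} [Lattice α] [IsModularLattice α]

theorem inf_sup_sup_eq (V F A : α) : V ⊓ (F ⊔ A) ⊔ A = F ⊓ (V ⊔ A) ⊔ A := by
  rw [sup_comm, ← sup_inf_assoc_of_le V le_sup_right, sup_comm (F ⊓ _),
    ← sup_inf_assoc_of_le F le_sup_right, inf_comm, sup_comm A V, sup_comm A F]

variable [OrderBot α]

theorem inf_sup_ne_bot_of_disjoint {V F A : α} (hVA : V ⊓ A = ⊥) (hX : V ⊓ (F ⊔ A) ≠ ⊥) :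
    F ⊓ (V ⊔ A) ≠ ⊥ := by
  intro h
  apply hX
  have hle : V ⊓ (F ⊔ A) ≤ A := by
    calc V ⊓ (F ⊔ A) ≤ (A ⊔ F) ⊓ (V ⊔ A) :=
          le_inf (inf_le_right.trans (sup_comm F A).le) (inf_le_left.trans le_sup_left)
      _ = A ⊔ F ⊓ (V ⊔ A) := sup_inf_assoc_of_le F le_sup_right
      _ = A := by rw [h, sup_bot_eq]
  exact le_bot_iff.1 ((le_inf inf_le_left hle).trans hVA.le)

theorem Finset.SupIndep.sup_inf_sup_erase {ι : Type*} [DecidableEq ι] {s T : Finset ι} {F : ι → α}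
    (h : s.SupIndep F) (hT : T ⊆ s) {k : ι} (hk : k ∈ T) :
    T.sup F ⊓ (s.erase k).sup F = (T.erase k).sup F := by
  have hdisj : F k ⊓ (s.erase k).sup F = ⊥ :=
    (h (s.erase_subset k) (hT hk) (s.notMem_erase k)).eq_bot
  conv_lhs => rw [← Finset.insert_erase hk, Finset.sup_insert, sup_comm]
  rw [sup_inf_assoc_of_le _ (Finset.sup_mono (Finset.erase_subset_erase k hT)), hdisj, sup_bot_eq]

theorem Finset.SupIndep.update {ι : Type*} [DecidableEq ι] {s : Finset ι} {F : ι → α}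
    (h : s.SupIndep F) {k : ι} {x : α} (hx : Disjoint x ((s.erase k).sup F)) :
    s.SupIndep (Function.update F k x) := by
  have hsup {t : Finset ι} (hkt : k ∉ t) : t.sup (Function.update F k x) = t.sup F :=
    Finset.sup_congr rfl fun j hj => Function.update_of_ne (ne_of_mem_of_not_mem hj hkt) _ _
  intro t ht i hi hit
  by_cases hik : i = k
  · subst hik
    rw [hsup hit, Function.update_self]
    exact hx.mono_right (Finset.sup_mono (Finset.subset_erase.2 ⟨ht, hit⟩))
  rw [Function.update_of_ne hik]
  by_cases hkt : k ∈ t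
  · rw [← Finset.insert_erase hkt, Finset.sup_insert, hsup (t.notMem_erase k),
      Function.update_self, sup_comm]
    have hte : t.erase k ⊆ s := (t.erase_subset k).trans ht
    have hie : i ∉ t.erase k := fun hmem => hit (Finset.mem_of_mem_erase hmem)
    refine (h hte hi hie).disjoint_sup_right_of_disjoint_sup_left (hx.symm.mono_left ?_)
    exact sup_le (Finset.le_sup (f := F) (Finset.mem_erase.2 ⟨hik, hi⟩))
      (Finset.sup_mono (Finset.erase_subset_erase k ht))
  · rw [hsup hkt]
    exact h ht hi hit

end Lattice

section Modules

variable {R : Type u} [Ring R] {M : Type v} [AddCommGroup M] [Module R M]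

theorem UniformSub.ne_bot {U : Submodule R M} (hU : UniformSub R U) : U ≠ ⊥ :=
  (Submodule.nontrivial_iff_ne_bot).1 hU.1

theorem comap_subtype_ne_bot {U X : Submodule R M} (h : U ⊓ X ≠ ⊥) : X.comap U.subtype ≠ ⊥ := by
  intro h0
  apply h
  rw [← Submodule.map_comap_subtype, h0, Submodule.map_bot]

theorem UniformSub.inf_inf_ne_bot {U X Y : Submodule R M} (hU : UniformSub R U)
    (hX : U ⊓ X ≠ ⊥) (hY : U ⊓ Y ≠ ⊥) : U ⊓ (X ⊓ Y) ≠ ⊥ := by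
  intro h
  apply hU.2 _ (comap_subtype_ne_bot hX) _ (comap_subtype_ne_bot hY)
  rw [← Submodule.comap_inf]
  apply Submodule.map_injective_of_injective U.injective_subtype
  rw [Submodule.map_comap_subtype, h, Submodule.map_bot]

/-- A submodule meeting `A` trivially is isomorphic to its image modulo `A`. -/
noncomputable def equivMapMkQ {X A : Submodule R M} (h : X ⊓ A = ⊥) : X ≃ₗ[R] X.map A.mkQ :=
  (LinearEquiv.ofInjective (A.mkQ.comp X.subtype) (by
    rw [← LinearMap.ker_eq_bot, LinearMap.ker_comp, Submodule.ker_mkQ]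
    apply Submodule.map_injective_of_injective X.injective_subtype
    rw [Submodule.map_comap_subtype, h, Submodule.map_bot])).trans
  (LinearEquiv.ofEq _ _ (by rw [LinearMap.range_comp, Submodule.range_subtype]))

theorem leftPrime_eq_of_inf_sup_ne_bot {V F A : Submodule R M} (hV : UniformSub R V)
    (hF : UniformSub R F) (hVA : V ⊓ A = ⊥) (hFA : F ⊓ A = ⊥) (hX : V ⊓ (F ⊔ A) ≠ ⊥) :
    leftPrime R V = leftPrime R F := by
  have hmap (X : Submodule R M) : (X ⊔ A).map A.mkQ = X.map A.mkQ := by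
    rw [Submodule.map_sup, Submodule.mkQ_map_self, sup_bot_eq]
  have himage : (V ⊓ (F ⊔ A)).map A.mkQ = (F ⊓ (V ⊔ A)).map A.mkQ := by
    rw [← hmap, inf_sup_sup_eq, hmap]
  have hXA : V ⊓ (F ⊔ A) ⊓ A = ⊥ := le_bot_iff.1 ((inf_le_inf_right A inf_le_left).trans hVA.le)
  have hYA : F ⊓ (V ⊔ A) ⊓ A = ⊥ := le_bot_iff.1 ((inf_le_inf_right A inf_le_left).trans hFA.le)
  have e (U X : Submodule R M) : Nonempty (X.comap U.subtype ≃ₗ[R] ↥(U ⊓ X)) :=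
    ⟨(Submodule.equivMapOfInjective U.subtype U.injective_subtype _).trans
      (LinearEquiv.ofEq _ _ (Submodule.map_comap_subtype U X))⟩
  obtain ⟨e₁⟩ := e V (F ⊔ A)
  obtain ⟨e₂⟩ := e F (V ⊔ A)
  refine Quot.sound ⟨(F ⊔ A).comap V.subtype, (V ⊔ A).comap F.subtype,
    hV.2 _ (comap_subtype_ne_bot hX),
    hF.2 _ (comap_subtype_ne_bot (inf_sup_ne_bot_of_disjoint hVA hX)), ⟨?_⟩⟩
  exact e₁.trans ((equivMapMkQ hXA).trans ((LinearEquiv.ofEq _ _ himage).trans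
    ((equivMapMkQ hYA).symm.trans e₂.symm)))

theorem EssentialSub.exchange {V F A : Submodule R M} (hess : EssentialSub R (F ⊔ A))
    (hF : UniformSub R F) (hV : V ≠ ⊥) (hVA : V ⊓ A = ⊥) (hFA : F ⊓ A = ⊥) :
    EssentialSub R (V ⊔ A) := by
  intro L hL hVL
  have hLA : L ⊓ A = ⊥ :=
    le_bot_iff.1 ((le_inf (inf_le_right.trans le_sup_right) inf_le_left).trans hVL.le)
  have hFV : F ⊓ (V ⊔ A) ≠ ⊥ :=
    inf_sup_ne_bot_of_disjoint hVA (by rw [inf_comm]; exact hess V hV)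
  have hFL : F ⊓ (L ⊔ A) ≠ ⊥ :=
    inf_sup_ne_bot_of_disjoint hLA (by rw [inf_comm]; exact hess L hL)
  apply hF.inf_inf_ne_bot hFV hFL
  have hinf : (V ⊔ A) ⊓ (L ⊔ A) = A := by
    rw [inf_comm, sup_comm L A, sup_inf_assoc_of_le L le_sup_right, inf_comm L, hVL, sup_bot_eq]
  rw [hinf, hFA]

/-- A uniform submodule `V` not meeting the sum of the `F j` with `j ∈ S` can replace
some `F k` with `k ∉ S` of the same class, keeping the sum direct and essential. -/
theorem exists_exchange {ι : Type*} [Fintype ι] [DecidableEq ι] {F : ι → Submodule R M}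
    {V : Submodule R M} (hF : ∀ i, UniformSub R (F i)) (hind : Finset.univ.SupIndep F)
    (hess : EssentialSub R (Finset.univ.sup F)) (hV : UniformSub R V) {S : Finset ι}
    (hVS : Disjoint V (S.sup F)) :
    ∃ k ∉ S, leftPrime R V = leftPrime R (F k) ∧
      Finset.univ.SupIndep (Function.update F k V) ∧
      EssentialSub R (Finset.univ.sup (Function.update F k V)) := by
  obtain ⟨T, hT⟩ := Set.Finite.exists_minimal (s := {T : Finset ι | V ⊓ T.sup F ≠ ⊥})
    (Set.toFinite _) ⟨Finset.univ, by
      rw [Set.mem_ofPred_eq, inf_comm]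
      exact hess V hV.ne_bot⟩
  have hTne : V ⊓ T.sup F ≠ ⊥ := hT.prop
  have hTS : ¬ T ⊆ S := fun hsub => hTne (hVS.mono_right (Finset.sup_mono hsub)).eq_bot
  obtain ⟨k, hkT, hkS⟩ := Finset.not_subset.1 hTS
  have hTk : V ⊓ (T.erase k).sup F = ⊥ := by
    by_contra hne
    exact T.notMem_erase k (hT.le_of_le hne (T.erase_subset k) hkT)
  set A := (Finset.univ.erase k).sup F with hA
  have hVA : V ⊓ A = ⊥ := by
    by_contra hne
    apply hV.inf_inf_ne_bot hTne hne
    rw [hA, hind.sup_inf_sup_erase (Finset.subset_univ T) hkT, hTk]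
  have hFA : F k ⊓ A = ⊥ :=
    (hind (Finset.erase_subset _ _) (Finset.mem_univ k) (Finset.notMem_erase k _)).eq_bot
  have hsum : Finset.univ.sup F = F k ⊔ A := by
    rw [← Finset.insert_erase (Finset.mem_univ k), Finset.sup_insert]
  have hsum' : Finset.univ.sup (Function.update F k V) = V ⊔ A := by
    rw [← Finset.insert_erase (Finset.mem_univ k), Finset.sup_insert, Function.update_self]
    congr 1
    exact Finset.sup_congr rfl fun j hj => Function.update_of_ne (Finset.ne_of_mem_erase hj) _ _
  rw [hsum] at hess
  refine ⟨k, hkS, ?_, hind.update (disjoint_iff.2 hVA), ?_⟩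
  · exact leftPrime_eq_of_inf_sup_ne_bot hV (hF k) hVA hFA
      (by rw [inf_comm]; exact hess V hV.ne_bot)
  · rw [hsum']
    exact hess.exchange (hF k) hV.ne_bot hVA hFA

theorem exists_perm_leftPrime_eq {ι : Type*} [Fintype ι] {W V : ι → Submodule R M}
    (hW : ∀ i, UniformSub R (W i)) (hWind : iSupIndep W) (hWess : EssentialSub R (⨆ i, W i))
    (hV : ∀ i, UniformSub R (V i)) (hVind : iSupIndep V) :
    ∃ σ : Equiv.Perm ι, ∀ i, leftPrime R (W (σ i)) = leftPrime R (V i) := by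
  classical
  have key (s : Finset ι) : ∃ (σ : Equiv.Perm ι) (F : ι → Submodule R M),
      (∀ i, UniformSub R (F i)) ∧ Finset.univ.SupIndep F ∧
      EssentialSub R (Finset.univ.sup F) ∧ (∀ i, leftPrime R (F i) = leftPrime R (W i)) ∧
      ∀ i ∈ s, F (σ i) = V i := by
    induction s using Finset.induction_on with
    | empty =>
      refine ⟨1, W, hW, iSupIndep_iff_supIndep_univ.1 hWind, ?_, fun _ => rfl, by simp⟩
      rwa [Finset.sup_univ_eq_iSup]
    | insert i s his ih =>
      obtain ⟨σ, F, hF, hind, hess, hclass, hFV⟩ := ih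
      have hdisj : Disjoint (V i) ((s.image σ).sup F) := by
        rw [Finset.sup_image, Finset.sup_congr (f := F ∘ σ) (g := V) rfl hFV]
        exact iSupIndep_iff_supIndep_univ.1 hVind (Finset.subset_univ s) (Finset.mem_univ i) his
      obtain ⟨k, hk, hVk, hind', hess'⟩ := exists_exchange hF hind hess (hV i) hdisj
      refine ⟨σ * Equiv.swap i (σ.symm k), Function.update F k (V i), fun j => ?_, hind', hess',
        fun j => ?_, fun j hj => ?_⟩
      · by_cases hjk : j = k
        · subst hjk
          rw [Function.update_self]
          exact hV i
        · rw [Function.update_of_ne hjk]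
          exact hF j
      · by_cases hjk : j = k
        · subst hjk
          rw [Function.update_self, hVk, hclass]
        · rw [Function.update_of_ne hjk, hclass]
      · rcases Finset.mem_insert.1 hj with rfl | hjs
        · simp
        · have hσj : σ j ≠ k := fun h => hk (h ▸ Finset.mem_image_of_mem σ hjs)
          rw [Equiv.Perm.mul_apply, Equiv.swap_apply_of_ne_of_ne (ne_of_mem_of_not_mem hjs his)
            (fun h => hσj (by rw [h, Equiv.apply_symm_apply])), Function.update_of_ne hσj,
            hFV j hjs]
  obtain ⟨σ, F, -, -, -, hclass, hFV⟩ := key Finset.univ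
  exact ⟨σ, fun i => by rw [← hclass, hFV i (Finset.mem_univ i)]⟩

end Modules

/-- Theorem `multUV`: if `M` is a nonzero module of finite uniform
dimension `n` and `U₁ ⊕ ⋯ ⊕ Uₙ`, `V₁ ⊕ ⋯ ⊕ Vₙ` are direct sums of uniform submodules
of `M`, then up to a permutation of the `Uᵢ` one has `[Uᵢ] = [Vᵢ]` for all `i`. -/
theorem uniform_summands_unique_up_to_permutation
    {R : Type u} [Ring R] {M : Type v} [AddCommGroup M] [Module R M]
    (hM : Nontrivial M) (n : ℕ) (hdim : UdimEq R M n)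
    (U V : Fin n → Submodule R M)
    (hU : ∀ i, UniformSub R (U i)) (hUind : iSupIndep U)
    (hV : ∀ i, UniformSub R (V i)) (hVind : iSupIndep V) :
    ∃ σ : Equiv.Perm (Fin n), ∀ i, leftPrime R ↥(U (σ i)) = leftPrime R ↥(V i) := by
  obtain ⟨W, hW, hWind, hWess⟩ := hdim
  obtain ⟨σ, hσ⟩ := exists_perm_leftPrime_eq hW hWind hWess hU hUind
  obtain ⟨τ, hτ⟩ := exists_perm_leftPrime_eq hW hWind hWess hV hVind
  refine ⟨σ.symm * τ, fun i => ?_⟩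
  rw [← hσ, ← hτ, Equiv.Perm.mul_apply, Equiv.apply_symm_apply]
end

section
/- Let M be a module of finite uniform dimension n ≥ 1 over a ring R, let U₁ ⊕ ⋯ ⊕ Uₙ be a direct sum of uniform submodules of M with n summands, and let L be a uniform submodule of M. Then [L] = [U_i] for some index i, i.e. L is essentially equivalent to some U_i. -/
/-!
Definitions following Bavula, "Primary decompositions for left Noetherian rings".
All modules are left modules over an associative ring `R` with 1.
-/

universe u v

section Helpers

variable {R : Type u} [Ring R] {M : Type v} [AddCommGroup M] [Module R M]

theorem UniformSub.exists_smul_mem {U D : Submodule R M} (hU : UniformSub R U)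
    (hD : U ⊓ D ≠ ⊥) {a : M} (ha : a ∈ U) (ha0 : a ≠ 0) :
    ∃ r : R, r • a ≠ 0 ∧ r • a ∈ D := by
  have hD' : D.comap U.subtype ≠ ⊥ := by
    obtain ⟨x, hx, hx0⟩ := Submodule.exists_mem_ne_zero_of_ne_bot hD
    refine (Submodule.ne_bot_iff _).2 ⟨⟨x, hx.1⟩, hx.2, fun h => hx0 ?_⟩
    simpa using congrArg Subtype.val h
  have hspan : Submodule.span R {(⟨a, ha⟩ : U)} ≠ ⊥ := by
    simpa [Submodule.span_singleton_eq_bot] using ha0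
  obtain ⟨y, hy, hy0⟩ := Submodule.exists_mem_ne_zero_of_ne_bot (hU.2 _ hD' _ hspan)
  obtain ⟨r, rfl⟩ := Submodule.mem_span_singleton.1 hy.2
  exact ⟨r, fun h => hy0 (Subtype.ext h), hy.1⟩

/-- A submodule meeting each of finitely many independent uniform submodules meets every cyclic
submodule of their sum. -/
theorem exists_smul_mem_of_mem_sup {κ : Type*} {V : κ → Submodule R M} {W : Submodule R M}
    (hV : ∀ j, UniformSub R (V j)) (hW : ∀ j, V j ⊓ W ≠ ⊥) (s : Finset κ)
    (hs : s.SupIndep V) {x : M} (hx : x ∈ s.sup V) (hx0 : x ≠ 0) :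
    ∃ r : R, r • x ≠ 0 ∧ r • x ∈ W := by
  classical
  induction s using Finset.induction generalizing x with
  | empty => simp_all
  | insert j s hj ih =>
    have hdisj : Disjoint (V j) (s.sup V) :=
      hs (Finset.subset_insert j s) (Finset.mem_insert_self j s) hj
    have ih' := @ih (hs.subset (Finset.subset_insert j s))
    rw [Finset.sup_insert] at hx
    obtain ⟨a, ha, b, hb, rfl⟩ := Submodule.mem_sup.1 hx
    by_cases ha0 : a = 0
    · subst ha0
      simpa using ih' hb (by simpa using hx0)
    obtain ⟨r, hr0, hr⟩ := (hV j).exists_smul_mem (hW j) ha ha0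
    by_cases hb0 : r • b = 0
    · exact ⟨r, by simpa [hb0] using hr0, by simpa [hb0] using hr⟩
    obtain ⟨t, ht0, ht⟩ := ih' (Submodule.smul_mem _ r hb) hb0
    refine ⟨t * r, fun h => ht0 ?_, ?_⟩
    · rw [mul_smul, smul_add, smul_add] at h
      refine Submodule.disjoint_def.1 hdisj _ ?_
        (Submodule.smul_mem _ t (Submodule.smul_mem _ r hb))
      rw [← neg_eq_of_add_eq_zero_right h]
      exact neg_mem (Submodule.smul_mem _ t (Submodule.smul_mem _ r ha))
    · rw [mul_smul, smul_add, smul_add]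
      exact add_mem (Submodule.smul_mem _ t hr) ht

/-- A submodule having zero intersection with a nonzero submodule has zero intersection with some
summand of an essential direct sum of uniform submodules. -/
theorem exists_disjoint_of_essentialSub {κ : Type*} [Fintype κ] {V : κ → Submodule R M}
    (hV : ∀ j, UniformSub R (V j)) (hind : iSupIndep V) (hess : EssentialSub R (⨆ j, V j))
    {X W : Submodule R M} (hX : X ≠ ⊥) (hXW : Disjoint X W) :
    ∃ j, Disjoint (V j) W := by
  by_contra! h
  obtain ⟨x, hx, hx0⟩ := Submodule.exists_mem_ne_zero_of_ne_bot (hess X hX)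
  obtain ⟨r, hr0, hr⟩ := exists_smul_mem_of_mem_sup hV
    (fun j hj => h j (disjoint_iff.2 hj)) Finset.univ hind.sup_indep_univ
    (by simpa [Finset.sup_univ_eq_iSup] using hx.1) hx0
  exact hr0 (Submodule.disjoint_def.1 hXW _ (Submodule.smul_mem _ r hx.2) hr)

/-- An independent family of nonzero submodules has at most as many members as an essential
direct sum of uniform submodules has summands. -/
theorem card_le_of_iSupIndep_of_essentialSub {ι κ : Type*} [Fintype ι] [Fintype κ]
    {V : κ → Submodule R M} (hV : ∀ j, UniformSub R (V j)) (hind : iSupIndep V)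
    (hess : EssentialSub R (⨆ j, V j)) {W : ι → Submodule R M} (hW : ∀ i, W i ≠ ⊥)
    (hWind : iSupIndep W) : Fintype.card ι ≤ Fintype.card κ := by
  classical
  have key : ∀ s : Finset ι, ∃ W' : ι → Submodule R M, (∀ i, W' i ≠ ⊥) ∧
      Finset.univ.SupIndep W' ∧ ∀ i ∈ s, ∃ j, W' i = V j := by
    intro s
    induction s using Finset.induction with
    | empty => exact ⟨W, hW, hWind.sup_indep_univ, by simp⟩
    | insert i s hi ih =>
      obtain ⟨W', h0, hW', hs⟩ := ih
      obtain ⟨j, hj⟩ := exists_disjoint_of_essentialSub hV hind hess (h0 i)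
        (Finset.supIndep_iff_disjoint_erase.1 hW' i (Finset.mem_univ i))
      have heq : ∀ k ∈ Finset.univ.erase i, W' k = Function.update W' i (V j) k := by
        intro k hk
        rw [Function.update_of_ne (Finset.ne_of_mem_erase hk)]
      refine ⟨Function.update W' i (V j), fun k => ?_, ?_, fun k hk => ?_⟩
      · by_cases hk : k = i
        · subst hk; simpa using (hV j).ne_bot
        · simpa [hk] using h0 k
      · rw [← Finset.insert_erase (Finset.mem_univ i)]
        refine Finset.SupIndep.insert ?_ ?_
        · exact (hW'.subset (Finset.subset_univ _)).mono fun k hk => (heq k hk).ge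
        · rw [← Finset.sup_congr rfl heq]
          simpa using hj
      · by_cases hki : k = i
        · exact ⟨j, by simp [hki]⟩
        · simpa [hki] using hs k (Finset.mem_of_mem_insert_of_ne hk hki)
  obtain ⟨W', h0, hW', hs⟩ := key Finset.univ
  choose g hg using fun i => hs i (Finset.mem_univ i)
  refine Fintype.card_le_of_injective g fun i k hik =>
    hW'.iSupIndep_of_univ.injective h0 ?_
  rw [hg i, hg k, hik]

/-- If a uniform submodule `L` meets `U ⊕ B` nontrivially but not `B`, with `U` uniform, then
`L` and `U` are essentially equivalent. -/
theorem essEquiv_of_inf_sup_ne_bot {L U B : Submodule R M} (hL : UniformSub R L)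
    (hU : UniformSub R U) (hUB : Disjoint U B) (hLB : Disjoint L B) (hLUB : L ⊓ (U ⊔ B) ≠ ⊥) :
    EssEquiv R (ModuleCat.of R L) (ModuleCat.of R U) := by
  let L' : Submodule R L := (U ⊔ B).comap L.subtype
  have hL' : L' ≠ ⊥ := by
    obtain ⟨x, hx, hx0⟩ := Submodule.exists_mem_ne_zero_of_ne_bot hLUB
    refine (Submodule.ne_bot_iff _).2 ⟨⟨x, hx.1⟩, hx.2, fun h => hx0 ?_⟩
    simpa using congrArg Subtype.val h
  let f : L' →ₗ[R] M ⧸ B := B.mkQ ∘ₗ L.subtype ∘ₗ L'.subtype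
  let g : U →ₗ[R] M ⧸ B := B.mkQ ∘ₗ U.subtype
  let U' : Submodule R U := (LinearMap.range f).comap g
  have hf : Function.Injective f := by
    refine (injective_iff_map_eq_zero f).2 fun x hx => ?_
    have hxB : (x : L).1 ∈ B := (Submodule.Quotient.mk_eq_zero B).1 hx
    exact Subtype.ext (Subtype.ext (Submodule.disjoint_def.1 hLB _ (x : L).2 hxB))
  have hg : Function.Injective g := by
    refine (injective_iff_map_eq_zero g).2 fun x hx => ?_
    have hxB : x.1 ∈ B := (Submodule.Quotient.mk_eq_zero B).1 hx
    exact Subtype.ext (Submodule.disjoint_def.1 hUB _ x.2 hxB)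
  have hfg : LinearMap.range f ≤ LinearMap.range g := by
    rintro _ ⟨x, rfl⟩
    obtain ⟨a, ha, b, hb, hab⟩ := Submodule.mem_sup.1 (show (x : L).1 ∈ U ⊔ B from x.2)
    refine ⟨⟨a, ha⟩, ((Submodule.Quotient.eq B).2 ?_ :
      (Submodule.Quotient.mk a : M ⧸ B) = Submodule.Quotient.mk (x : L).1)⟩
    rw [← hab]
    simpa using hb
  have hrange : LinearMap.range (g.domRestrict U') = LinearMap.range f := by
    rw [LinearMap.range_domRestrict, Submodule.map_comap_eq, inf_eq_right.2 hfg]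
  have hg' : Function.Injective (g.domRestrict U') := fun x y h => Subtype.ext (hg h)
  let e : L' ≃ₗ[R] U' := (LinearEquiv.ofInjective f hf).trans
    ((LinearEquiv.ofEq _ _ hrange.symm).trans (LinearEquiv.ofInjective _ hg').symm)
  have hU' : U' ≠ ⊥ := by
    rw [← Submodule.nontrivial_iff_ne_bot] at hL' ⊢
    exact e.symm.toEquiv.nontrivial
  exact ⟨L', U', hL.2 L' hL', hU.2 U' hU', ⟨e⟩⟩

theorem exists_essEquiv_of_inf_sup_ne_bot {ι : Type*} {U : ι → Submodule R M}
    (hU : ∀ i, UniformSub R (U i)) {L : Submodule R M} (hL : UniformSub R L) (s : Finset ι)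
    (hs : s.SupIndep U) (hLs : L ⊓ s.sup U ≠ ⊥) :
    ∃ i, EssEquiv R (ModuleCat.of R L) (ModuleCat.of R (U i)) := by
  classical
  induction s using Finset.induction with
  | empty => simp at hLs
  | insert j s hj ih =>
    by_cases h : L ⊓ s.sup U = ⊥
    · rw [Finset.sup_insert] at hLs
      exact ⟨j, essEquiv_of_inf_sup_ne_bot hL (hU j)
        (hs (Finset.subset_insert j s) (Finset.mem_insert_self j s) hj) (disjoint_iff.2 h) hLs⟩
    · exact ih (hs.subset (Finset.subset_insert j s)) h

/-- In a module of uniform dimension `n`, every direct sum of `n` nonzero submodules is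
essential. -/
theorem UdimEq.essentialSub_iSup {n : ℕ} (hdim : UdimEq R M n) {U : Fin n → Submodule R M}
    (hU : ∀ i, U i ≠ ⊥) (hind : iSupIndep U) : EssentialSub R (⨆ i, U i) := by
  intro L hL h
  obtain ⟨V, hV, hVind, hVess⟩ := hdim
  let W : Option (Fin n) → Submodule R M := fun o => o.elim L U
  have hW : Finset.univ.SupIndep W := by
    have hdisj : Disjoint L (⨆ i, U i) := disjoint_iff.2 (inf_comm L _ ▸ h)
    have huniv : (Finset.univ : Finset (Option (Fin n))) =
        insert none (Finset.univ.map Function.Embedding.some) := by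
      ext (_ | _) <;> simp
    rw [huniv]
    refine Finset.SupIndep.insert (Finset.supIndep_map.2 hind.sup_indep_univ) ?_
    rw [Finset.sup_map, Finset.sup_univ_eq_iSup]
    exact hdisj
  have hcard := card_le_of_iSupIndep_of_essentialSub hV hVind hVess
    (W := W) (by rintro (_ | i); exacts [hL, hU i]) hW.iSupIndep_of_univ
  simp at hcard

end Helpers

/-- Corollary to Theorem `multUV`: if `M` has finite uniform dimension
`n ≥ 1`, `U₁ ⊕ ⋯ ⊕ Uₙ` is a direct sum of uniform submodules of `M` and `L` is a uniform
submodule of `M`, then `[L] = [Uᵢ]` for some `i`. -/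
theorem uniform_submodule_equivalent_to_some_summand
    {R : Type u} [Ring R] {M : Type v} [AddCommGroup M] [Module R M]
    (n : ℕ) (hn : 1 ≤ n) (hdim : UdimEq R M n)
    (U : Fin n → Submodule R M)
    (hU : ∀ i, UniformSub R (U i)) (hUind : iSupIndep U)
    (L : Submodule R M) (hL : UniformSub R L) :
    ∃ i, leftPrime R ↥L = leftPrime R ↥(U i) := by
  have hess := hdim.essentialSub_iSup (fun i => (hU i).ne_bot) hUind
  obtain ⟨i, hi⟩ := exists_essEquiv_of_inf_sup_ne_bot hU hL Finset.univ hUind.sup_indep_univ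
    (by rw [Finset.sup_univ_eq_iSup, inf_comm]; exact hess L hL.ne_bot)
  exact ⟨i, Quot.sound hi⟩
end

section
/- Let M₁, ..., Mₙ be nonzero submodules of finite uniform dimension of an R-module M such that As_R(M_i) ∩ As_R(M_j) = ∅ for all i ≠ j. Then the sum M₁ + ⋯ + Mₙ is direct, i.e. M₁ + ⋯ + Mₙ = M₁ ⊕ ⋯ ⊕ Mₙ. -/
/-!
Definitions following Bavula, "Primary decompositions for left Noetherian rings".
All modules are left modules over an associative ring `R` with 1.
-/

universe u v

section Aux

variable {R : Type u} [Ring R] {A : Type v} [AddCommGroup A] [Module R A]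
  {B : Type v} [AddCommGroup B] [Module R B]

/-- If every `W k` avoids the member `V (k + 1)` of a decreasing chain of submodules with
`W k ≤ V k`, then the `W k` are independent. -/
lemma iSupIndep_of_disjoint_antitone {V W : ℕ → Submodule R A} (hV : Antitone V)
    (hWV : ∀ k, W k ≤ V k) (hd : ∀ k, Disjoint (W k) (V (k + 1))) : iSupIndep W := by
  rw [iSupIndep_iff_finsetSum_eq_zero_imp_eq_zero]
  intro s v hv hsum k
  induction k using Nat.strong_induction_on with
  | _ k ih =>
    intro hk
    have hrest : ∑ i ∈ s.erase k, v i ∈ V (k + 1) := by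
      refine Submodule.sum_mem _ fun i hi => ?_
      obtain ⟨hik, his⟩ := Finset.mem_erase.mp hi
      rcases lt_or_gt_of_ne hik with h | h
      · rw [ih i h his]
        exact zero_mem _
      · exact hV h (hWV i (hv i his))
    have hsplit := Finset.add_sum_erase s v hk
    rw [hsum] at hsplit
    refine Submodule.disjoint_def.mp (hd k) _ (hv k hk) ?_
    rw [eq_neg_of_add_eq_zero_left hsplit]
    exact neg_mem hrest

lemma UniformMod.of_linearEquiv (e : A ≃ₗ[R] B) (h : UniformMod R A) : UniformMod R B := by
  obtain ⟨hA, hess⟩ := h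
  refine ⟨e.symm.toEquiv.nontrivial, fun V hV L hL hVL => ?_⟩
  have hne : ∀ N : Submodule R B, N ≠ ⊥ → N.comap e.toLinearMap ≠ ⊥ := by
    intro N hN h0
    obtain ⟨x, hx, hx0⟩ := Submodule.exists_mem_ne_zero_of_ne_bot hN
    have : e.symm x ∈ N.comap e.toLinearMap := by simpa using hx
    rw [h0, Submodule.mem_bot] at this
    exact hx0 (by simpa using this)
  refine hess _ (hne V hV) _ (hne L hL) ?_
  rw [← Submodule.comap_inf, hVL, Submodule.comap_bot]
  exact LinearMap.ker_eq_bot.mpr e.injective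

lemma leftPrime_eq_of_linearEquiv (e : A ≃ₗ[R] B) : leftPrime R A = leftPrime R B := by
  refine Quot.sound ⟨⊤, ⊤, ?_, ?_, ⟨?_⟩⟩
  · intro L hL
    rwa [top_inf_eq]
  · intro L hL
    rwa [top_inf_eq]
  · exact Submodule.topEquiv.trans (e.trans Submodule.topEquiv.symm)

lemma leftAss_subset_of_injective (f : A →ₗ[R] B) (hf : Function.Injective f) :
    leftAss R A ⊆ leftAss R B := by
  rintro x ⟨U, hU, rfl⟩
  have e := Submodule.equivMapOfInjective f hf U
  exact ⟨U.map f, UniformMod.of_linearEquiv e hU, leftPrime_eq_of_linearEquiv e⟩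

lemma FinUdim.of_injective (f : A →ₗ[R] B) (hf : Function.Injective f) (hB : FinUdim R B) :
    FinUdim R A := by
  rintro ⟨W, hW, hind⟩
  refine hB ⟨fun k => (W k).map f, fun k hk => hW k ?_, f.iSupIndep_map hf hind⟩
  exact Submodule.map_injective_of_injective hf (hk.trans (Submodule.map_bot f).symm)

/-- A nonzero submodule that is not uniform contains two nonzero disjoint submodules. -/
lemma exists_disjoint_of_not_uniformSub {U : Submodule R A} (hU : U ≠ ⊥)
    (h : ¬ UniformSub R U) :
    ∃ V W : Submodule R A, V ≤ U ∧ W ≤ U ∧ V ≠ ⊥ ∧ W ≠ ⊥ ∧ Disjoint W V := by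
  have : ∃ V : Submodule R U, V ≠ ⊥ ∧ ∃ W : Submodule R U, W ≠ ⊥ ∧ V ⊓ W = ⊥ := by
    by_contra! hcon
    exact h ⟨Submodule.nontrivial_iff_ne_bot.mpr hU, fun V hV W hW => hcon V hV W hW⟩
  obtain ⟨V, hV, W, hW, hVW⟩ := this
  have hinj := U.injective_subtype
  refine ⟨V.map U.subtype, W.map U.subtype, U.map_subtype_le V, U.map_subtype_le W,
    fun h0 => hV (Submodule.map_injective_of_injective hinj (h0.trans (Submodule.map_bot _).symm)),
    fun h0 => hW (Submodule.map_injective_of_injective hinj (h0.trans (Submodule.map_bot _).symm)), ?_⟩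
  rw [disjoint_comm, disjoint_iff, ← Submodule.map_inf _ hinj, hVW, Submodule.map_bot]

lemma FinUdim.exists_uniformSub [Nontrivial A] (hA : FinUdim R A) :
    ∃ U : Submodule R A, UniformSub R U := by
  by_contra! hcon
  have hstep (U : {U : Submodule R A // U ≠ ⊥}) :=
    exists_disjoint_of_not_uniformSub U.2 (hcon U.1)
  choose V W hVU hWU hV hW hd using hstep
  let c : ℕ → {U : Submodule R A // U ≠ ⊥} := fun k => (fun U => ⟨V U, hV U⟩)^[k] ⟨⊤, top_ne_bot⟩
  have hc (k : ℕ) : (c (k + 1)).1 = V (c k) := by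
    simp only [c, Function.iterate_succ_apply']
  refine hA ⟨fun k => W (c k), fun k => hW _,
    iSupIndep_of_disjoint_antitone (V := fun k => (c k).1) ?_ (fun k => hWU _) fun k => ?_⟩
  · exact antitone_nat_of_succ_le fun k => (hc k).trans_le (hVU _)
  · rw [hc]
    exact hd _

lemma FinUdim.leftAss_nonempty [Nontrivial A] (hA : FinUdim R A) : (leftAss R A).Nonempty :=
  let ⟨U, hU⟩ := hA.exists_uniformSub
  ⟨_, U, hU, rfl⟩

/-- The linear relations `∑ i, x i = 0` between elements `x i ∈ N i` that are supported
in `s`. -/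
def relationsOn {ι : Type*} [Fintype ι] (N : ι → Submodule R A) (s : Finset ι) :
    Submodule R (∀ i, N i) where
  carrier := {x | ∑ i, (x i : A) = 0 ∧ ∀ i ∉ s, x i = 0}
  zero_mem' := by simp
  add_mem' := by
    rintro x y ⟨hx, hx'⟩ ⟨hy, hy'⟩
    refine ⟨by simp [Finset.sum_add_distrib, hx, hy], fun i hi => ?_⟩
    simp [hx' i hi, hy' i hi]
  smul_mem' := by
    rintro r x ⟨hx, hx'⟩
    refine ⟨by simp [← Finset.smul_sum, hx], fun i hi => ?_⟩
    simp [hx' i hi]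

lemma exists_relationsOn_ne_bot {ι : Type*} [Fintype ι] {N : ι → Submodule R A}
    (h : ¬ iSupIndep N) : ∃ s, relationsOn N s ≠ ⊥ := by
  classical
  rw [iSupIndep_iff_finsetSum_eq_zero_imp_eq_zero] at h
  push Not at h
  obtain ⟨s, v, hv, hsum, i, hi, hvi⟩ := h
  let x : ∀ i, N i := fun i => if hi : i ∈ s then ⟨v i, hv i hi⟩ else 0
  have hx (i : ι) : (x i : A) = if i ∈ s then v i else 0 := by
    by_cases hi : i ∈ s <;> simp [x, hi]
  refine ⟨s, Submodule.ne_bot_iff _ |>.mpr ⟨x, ⟨?_, fun j hj => ?_⟩, fun h0 => hvi ?_⟩⟩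
  · simpa [hx] using hsum
  · simp [x, hj]
  · simpa [h0, hi] using (hx i).symm

/-- On a minimal support of nonzero relations, every coordinate of that support is injective. -/
lemma injective_proj_relationsOn {ι : Type*} [Fintype ι] {N : ι → Submodule R A} {s : Finset ι}
    (hs : Minimal (fun s => relationsOn N s ≠ ⊥) s) {i : ι} (hi : i ∈ s) :
    Function.Injective ((LinearMap.proj i : (∀ i, N i) →ₗ[R] N i).domRestrict
      (relationsOn N s)) := by
  classical
  rw [← LinearMap.ker_eq_bot, LinearMap.ker_eq_bot']
  rintro ⟨x, hx⟩ hxi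
  have hxi : x i = 0 := hxi
  have hbot : relationsOn N (s.erase i) = ⊥ := by
    by_contra hne
    exact Finset.notMem_erase i s (hs.2 hne (Finset.erase_subset i s) hi)
  have hmem : x ∈ relationsOn N (s.erase i) := by
    refine ⟨hx.1, fun j hj => ?_⟩
    by_cases hji : j = i
    · exact hji ▸ hxi
    · exact hx.2 j fun hjs => hj (Finset.mem_erase.mpr ⟨hji, hjs⟩)
  rw [hbot, Submodule.mem_bot] at hmem
  exact Subtype.ext hmem

lemma exists_ne_mem_of_relationsOn_ne_bot {ι : Type*} [Fintype ι] {N : ι → Submodule R A}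
    {s : Finset ι} (h : relationsOn N s ≠ ⊥) : ∃ i ∈ s, ∃ j ∈ s, i ≠ j := by
  obtain ⟨x, hx, hx0⟩ := Submodule.exists_mem_ne_zero_of_ne_bot h
  obtain ⟨i, hi⟩ := Function.ne_iff.mp hx0
  by_contra! hcon
  have hmem {j : ι} (hj : x j ≠ 0) : j ∈ s := by
    by_contra hjs
    exact hj (hx.2 j hjs)
  refine hi (Subtype.ext ?_)
  have hsum := hx.1
  rwa [Fintype.sum_eq_single i fun j hj => ?_] at hsum
  by_contra hxj
  exact hj (hcon j (hmem fun h0 => hxj (by simp [h0])) i (hmem hi))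

end Aux

/-- Lemma `Asdirs`(3): if `M₁, …, Mₙ` are nonzero submodules of `M`
of finite uniform dimension with `As_R(Mᵢ) ∩ As_R(Mⱼ) = ∅` for `i ≠ j`, then the sum
`M₁ + ⋯ + Mₙ` is direct. -/
theorem sum_directed_of_disjoint_leftAss
    {R : Type u} [Ring R] {M : Type v} [AddCommGroup M] [Module R M]
    (n : ℕ) (Ms : Fin n → Submodule R M)
    (hne : ∀ i, Ms i ≠ ⊥) (hfin : ∀ i, FinUdim R ↥(Ms i))
    (hdisj : ∀ i j, i ≠ j → leftAss R ↥(Ms i) ∩ leftAss R ↥(Ms j) = ∅) :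
    iSupIndep Ms := by
  by_contra hind
  obtain ⟨s, hs⟩ := exists_minimal_of_wellFoundedLT _ (exists_relationsOn_ne_bot hind)
  obtain ⟨i, hi, j, hj, hij⟩ := exists_ne_mem_of_relationsOn_ne_bot hs.1
  have hinj_i := injective_proj_relationsOn hs hi
  have hinj_j := injective_proj_relationsOn hs hj
  have : Nontrivial (relationsOn Ms s) := Submodule.nontrivial_iff_ne_bot.mpr hs.1
  obtain ⟨x, hx⟩ := ((hfin i).of_injective _ hinj_i).leftAss_nonempty
  have hmem : x ∈ leftAss R (Ms i) ∩ leftAss R (Ms j) :=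
    ⟨leftAss_subset_of_injective _ hinj_i hx, leftAss_subset_of_injective _ hinj_j hx⟩
  rwa [hdisj i j hij] at hmem
end

section
/- Let M be a nonzero uniformly finite R-module and N a submodule of M with N ≠ M. Then N admits a primary decomposition in M, i.e. N = N₁ ∩ ⋯ ∩ N_s for some primary submodules N₁, ..., N_s of M. -/
/-!
Definitions following Bavula, "Primary decompositions for left Noetherian rings".
All modules are left modules over an associative ring `R` with 1.
-/

universe u v

section Auxiliary

variable {R : Type u} [Ring R] {A : Type v} [AddCommGroup A] [Module R A]

/-- If each `U k` lies in the `k`-th term of a decreasing sequence of submodules and is disjoint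
from the next term, then the `U k` are independent. -/
theorem iSupIndep_of_antitone_of_disjoint {U K : ℕ → Submodule R A} (hK : Antitone K)
    (hUK : ∀ k, U k ≤ K k) (hdisj : ∀ k, Disjoint (U k) (K (k + 1))) : iSupIndep U := by
  classical
  rw [iSupIndep_iff_finsetSum_eq_zero_imp_eq_zero]
  intro s v hv hsum i
  induction i using Nat.strong_induction_on with
  | _ i ih =>
    intro hi
    have hrest : ∑ j ∈ s.erase i, v j ∈ K (i + 1) := by
      refine Submodule.sum_mem _ fun j hj => ?_
      obtain ⟨hji, hjs⟩ := Finset.mem_erase.mp hj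
      rcases lt_or_gt_of_ne hji with h | h
      · rw [ih j h hjs]
        exact Submodule.zero_mem _
      · exact hK h (hUK j (hv j hjs))
    have heq : v i = -∑ j ∈ s.erase i, v j := by
      rw [← Finset.add_sum_erase s v hi] at hsum
      exact eq_neg_of_add_eq_zero_left hsum
    refine Submodule.disjoint_def.mp (hdisj i) (v i) (hv i hi) ?_
    rw [heq]
    exact Submodule.neg_mem _ hrest

/-- In a module of finite uniform dimension, a property of submodules which passes from every
nonzero `K` to some `K' ≤ K` missing a nonzero submodule of `K` holds for the zero submodule. -/
theorem FinUdim.bot_of_forall_exists_disjoint (hA : FinUdim R A) {P : Submodule R A → Prop}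
    (hP : ∀ K, P K → K ≠ ⊥ → ∃ U K', U ≠ ⊥ ∧ U ≤ K ∧ K' ≤ K ∧ Disjoint U K' ∧ P K')
    {K₀ : Submodule R A} (h₀ : P K₀) : P ⊥ := by
  by_contra hbot
  have hne : ∀ K, P K → K ≠ ⊥ := fun K hK h => hbot (h ▸ hK)
  choose U K' hU hUK hK'K hdisj hPK' using fun K : {K // P K} => hP K K.2 (hne K K.2)
  let f : ℕ → {K // P K} := fun n => Nat.rec ⟨K₀, h₀⟩ (fun _ K => ⟨K' K, hPK' K⟩) n
  refine hA ⟨fun n => U (f n), fun n => hU _, ?_⟩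
  have hf : Antitone fun n => (f n).1 := antitone_nat_of_succ_le fun n => hK'K (f n)
  exact iSupIndep_of_antitone_of_disjoint hf (fun n => hUK (f n)) (fun n => hdisj (f n))

theorem FinUdim.exists_le_forall_not_disjoint (hA : FinUdim R A) {L : Submodule R A}
    (hL : L ≠ ⊥) :
    ∃ U ≤ L, U ≠ ⊥ ∧ ∀ V W, V ≤ U → W ≤ U → V ≠ ⊥ → W ≠ ⊥ → ¬Disjoint V W := by
  by_contra! h
  refine (hA.bot_of_forall_exists_disjoint (P := fun K => K ≤ L ∧ K ≠ ⊥) ?_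
    (K₀ := L) ⟨le_rfl, hL⟩).2 rfl
  rintro K ⟨hKL, -⟩ hK
  obtain ⟨V, W, hV, hW, hV0, hW0, hVW⟩ := h K hKL hK
  exact ⟨V, W, hV0, hV, hW, hVW, hW.trans hKL, hW0⟩

theorem exists_maximal_disjoint (U : Submodule R A) :
    ∃ C : Submodule R A, Maximal (Disjoint U) C := by
  refine zorn_le₀ {C | Disjoint U C} fun c hc hchain => ⟨sSup c, ?_, fun z hz => le_sSup hz⟩
  exact hchain.directedOn.disjoint_sSup_right.mpr fun z hz => hc hz

theorem infIrred_of_maximal_disjoint {U C : Submodule R A} (hU : U ≠ ⊥)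
    (hunif : ∀ V W, V ≤ U → W ≤ U → V ≠ ⊥ → W ≠ ⊥ → ¬Disjoint V W)
    (hC : Maximal (Disjoint U) C) : InfIrred C := by
  refine ⟨fun h => hU ?_, fun P Q hPQ => ?_⟩
  · have := hC.prop
    rwa [isMax_iff_eq_top.mp h, disjoint_top] at this
  · by_contra! hne
    have key : ∀ P, C ≤ P → P ≠ C → U ⊓ P ≠ ⊥ := fun P hCP hPC h =>
      hPC (hC.eq_of_ge (disjoint_iff.mpr h) hCP)
    refine hunif _ _ inf_le_left inf_le_left (key P (hPQ ▸ inf_le_left) hne.1)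
      (key Q (hPQ ▸ inf_le_right) hne.2) (disjoint_iff_inf_le.mpr ?_)
    rw [← inf_inf_distrib_left, hPQ]
    exact hC.prop.le_bot

/-- In a module of finite uniform dimension, zero is a finite intersection of meet-irreducible
submodules. -/
theorem FinUdim.exists_finset_infIrred_inf_eq_bot (hA : FinUdim R A) :
    ∃ t : Finset (Submodule R A), (∀ C ∈ t, InfIrred C) ∧ t.inf id = ⊥ := by
  classical
  refine hA.bot_of_forall_exists_disjoint
    (P := fun K => ∃ t : Finset (Submodule R A), (∀ C ∈ t, InfIrred C) ∧ t.inf id = K) ?_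
    (K₀ := ⊤) ⟨∅, by simp, by simp⟩
  rintro K ⟨t, ht, rfl⟩ hK
  obtain ⟨U, hUK, hU, hunif⟩ := hA.exists_le_forall_not_disjoint hK
  obtain ⟨C, hC⟩ := exists_maximal_disjoint U
  refine ⟨U, C ⊓ t.inf id, hU, hUK, inf_le_right, hC.prop.mono_right inf_le_left, insert C t,
    ?_, by simp⟩
  simpa using ⟨infIrred_of_maximal_disjoint hU hunif hC, ht⟩

theorem infIrred_comap_iff {B : Type*} [AddCommGroup B] [Module R B] {f : A →ₗ[R] B}
    (hf : Function.Surjective f) {C : Submodule R B} : InfIrred (C.comap f) ↔ InfIrred C := by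
  have hinj := Submodule.comap_injective_of_surjective hf
  have hmax : IsMax (C.comap f) ↔ IsMax C := by
    rw [isMax_iff_eq_top, isMax_iff_eq_top, ← hinj.eq_iff, Submodule.comap_top]
  refine and_congr (not_congr hmax) ⟨fun h P Q hPQ => ?_, fun h P Q hPQ => ?_⟩
  · rw [← hinj.eq_iff, ← hinj.eq_iff (a := Q)]
    exact h (by rw [← Submodule.comap_inf, hPQ])
  · have key : ∀ P, C.comap f ≤ P → (P.map f).comap f = P := fun P hP =>
      Submodule.comap_map_eq_self ((LinearMap.ker_le_comap f).trans hP)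
    have hP := key P (hPQ ▸ inf_le_left)
    have hQ := key Q (hPQ ▸ inf_le_right)
    rw [← hP, ← hQ, hinj.eq_iff, hinj.eq_iff]
    exact h (hinj (by rw [Submodule.comap_inf, hP, hQ, hPQ]))

theorem uniformMod_iff_infIrred_bot : UniformMod R A ↔ InfIrred (⊥ : Submodule R A) := by
  have hmax : Nontrivial A ↔ ¬IsMax (⊥ : Submodule R A) := by
    rw [isMax_iff_eq_top, subsingleton_iff_bot_eq_top, Submodule.subsingleton_iff,
      not_subsingleton_iff_nontrivial]
  refine and_congr hmax ⟨fun h P Q hPQ => ?_, fun h V hV L hL hVL => ?_⟩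
  · by_contra! hne
    exact h P hne.1 Q hne.2 hPQ
  · exact (h hVL).elim hV hL

theorem leftPrime_eq_of_essentialSub {U : Submodule R A} (hU : EssentialSub R U) :
    leftPrime R ↥U = leftPrime R A :=
  Quot.sound ⟨⊤, U, fun L hL => by rwa [top_inf_eq], hU, ⟨Submodule.topEquiv⟩⟩

theorem UniformMod.leftAss_eq (hA : UniformMod R A) : leftAss R A = {leftPrime R A} := by
  ext x
  constructor
  · rintro ⟨U, hU, rfl⟩
    have := hU.1
    exact leftPrime_eq_of_essentialSub (hA.2 U (Submodule.nontrivial_iff_ne_bot.mp this))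
  · rintro rfl
    refine ⟨⊤, ?_, (leftPrime_eq_of_essentialSub fun L hL => by rwa [top_inf_eq]).symm⟩
    have hbot : (⊥ : Submodule R A).comap (Submodule.topEquiv (R := R) (M := A)).toLinearMap = ⊥ :=
      (Submodule.topEquiv (R := R) (M := A)).ker
    rw [UniformSub, uniformMod_iff_infIrred_bot, ← hbot,
      infIrred_comap_iff (Submodule.topEquiv (R := R) (M := A)).surjective]
    exact uniformMod_iff_infIrred_bot.mp hA

theorem InfIrred.uniformMod_quotient {C : Submodule R A} (hC : InfIrred C) :
    UniformMod R (A ⧸ C) := by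
  rw [uniformMod_iff_infIrred_bot, ← infIrred_comap_iff C.mkQ_surjective]
  rwa [Submodule.comap_bot, Submodule.ker_mkQ]

end Auxiliary

/-- Theorem `RlufAss`, existence: every proper submodule `N` of a
nonzero uniformly finite module `M` admits a primary decomposition in `M`. -/
theorem exists_primaryDecomposition
    {R : Type u} [Ring R] {M : Type v} [AddCommGroup M] [Module R M]
    (hM : Nontrivial M) (huf : UniformlyFinite R M)
    (N : Submodule R M) (hN : N ≠ ⊤) :
    ∃ (s : ℕ) (Ns : Fin s → Submodule R M), IsPrimaryDecomp R N s Ns := by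
  obtain ⟨t, ht, hinf⟩ := (huf N).exists_finset_infIrred_inf_eq_bot
  refine ⟨t.card, fun i => (t.equivFin.symm i : Submodule R (M ⧸ N)).comap N.mkQ, ?_,
    fun i => ⟨leftPrime R _, huf _, UniformMod.leftAss_eq (InfIrred.uniformMod_quotient ?_)⟩⟩
  · rw [← Submodule.comap_iInf,
      t.equivFin.symm.iInf_comp (g := fun C : t => (C : Submodule R (M ⧸ N))), iInf_subtype, ← Finset.inf_eq_iInf t fun C => C]
    change N = Submodule.comap N.mkQ (t.inf id)
    rw [hinf, Submodule.comap_bot, Submodule.ker_mkQ]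
  · exact (infIrred_comap_iff N.mkQ_surjective).mpr (ht _ (t.equivFin.symm i).2)
end
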